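/- Let u be a nonconstant solution of -Δu = f(u) in B₁ with (0,0) a degenerate local maximum point satisfying u_xx(0,0) = u_xy(0,0) = 0, and assume ∂u/∂x ≢ 0 on B₁. Let n ≥ 3 be the smallest integer such that ∂ⁿu/∂x^{n-k}∂y^k(0,0) ≠ 0 for some k ∈ {0,…,n-1}. If n is odd, then ∂ⁿu/∂xⁿ(0,0) = 0, ∂ⁿu/∂x^{n-1}∂y(0,0) ≠ 0, and the smallest integer l > n with ∂ˡu/∂xˡ(0,0) ≠ 0 exists, satisfies n+1 ≤ l ≤ 2n-2, and ∂ˡu/∂xˡ(0,0) < 0. -/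

import Mathlib

open Filter Metric Set

/-- Partial derivative in the first variable. -/
noncomputable def pdx (u : ℝ → ℝ → ℝ) : ℝ → ℝ → ℝ := fun x y => deriv (fun t => u t y) x

/-- Partial derivative in the second variable. -/
noncomputable def pdy (u : ℝ → ℝ → ℝ) : ℝ → ℝ → ℝ := fun x y => deriv (fun t => u x t) y

/-- `pd u i j = ∂^(i+j) u / ∂x^i ∂y^j`. -/
noncomputable def pd (u : ℝ → ℝ → ℝ) (i j : ℕ) : ℝ → ℝ → ℝ := pdx^[i] (pdy^[j] u)

/-- The open unit ball of `ℝ²`. -/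
def B1 : Set (ℝ × ℝ) := Metric.ball (0 : ℝ × ℝ) 1

/-- Real part of `(x+iy)^n`. -/
noncomputable def ReZ (n : ℕ) (x y : ℝ) : ℝ := (((x : ℂ) + (y : ℂ) * Complex.I) ^ n).re

/-- Imaginary part of `(x+iy)^n`. -/
noncomputable def ImZ (n : ℕ) (x y : ℝ) : ℝ := (((x : ℂ) + (y : ℂ) * Complex.I) ^ n).im

open Topology

/-- Smoothness on the unit ball. -/
def Sm (u : ℝ → ℝ → ℝ) : Prop := ContDiffOn ℝ (⊤ : ℕ∞) (fun p : ℝ × ℝ => u p.1 p.2) B1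

/-- Equality on the unit ball. -/
def EqB (u v : ℝ → ℝ → ℝ) : Prop := ∀ x y, (x, y) ∈ B1 → u x y = v x y

lemma B1_open : IsOpen B1 := Metric.isOpen_ball

lemma B1_zero : ((0 : ℝ), (0 : ℝ)) ∈ B1 := by
  simp [B1]

lemma EqB.trans {u v w} (h : EqB u v) (h' : EqB v w) : EqB u w :=
  fun x y hp => (h x y hp).trans (h' x y hp)

lemma EqB.symm {u v} (h : EqB u v) : EqB v u :=
  fun x y hp => (h x y hp).symm

lemma Sm.diffAt {u} (h : Sm u) {x y} (hp : (x, y) ∈ B1) :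
    DifferentiableAt ℝ (fun p : ℝ × ℝ => u p.1 p.2) (x, y) :=
  (h.contDiffAt (B1_open.mem_nhds hp)).differentiableAt (by simp)

lemma Sm.hasx {u} (h : Sm u) {x y} (hp : (x, y) ∈ B1) :
    HasDerivAt (fun t => u t y) (fderiv ℝ (fun p : ℝ × ℝ => u p.1 p.2) (x, y) (1, 0)) x := by
  have h1 : HasDerivAt (fun t : ℝ => (t, y)) ((1 : ℝ), (0 : ℝ)) x :=
    (hasDerivAt_id x).prodMk (hasDerivAt_const x y)
  exact ((h.diffAt hp).hasFDerivAt.comp_hasDerivAt x h1)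

lemma Sm.hasy {u} (h : Sm u) {x y} (hp : (x, y) ∈ B1) :
    HasDerivAt (fun t => u x t) (fderiv ℝ (fun p : ℝ × ℝ => u p.1 p.2) (x, y) (0, 1)) y := by
  have h1 : HasDerivAt (fun t : ℝ => (x, t)) ((0 : ℝ), (1 : ℝ)) y :=
    (hasDerivAt_const y x).prodMk (hasDerivAt_id y)
  exact ((h.diffAt hp).hasFDerivAt.comp_hasDerivAt y h1)

lemma Sm.pdx_eq {u} (h : Sm u) {x y} (hp : (x, y) ∈ B1) :
    pdx u x y = fderiv ℝ (fun p : ℝ × ℝ => u p.1 p.2) (x, y) (1, 0) := (h.hasx hp).deriv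

lemma Sm.pdy_eq {u} (h : Sm u) {x y} (hp : (x, y) ∈ B1) :
    pdy u x y = fderiv ℝ (fun p : ℝ × ℝ => u p.1 p.2) (x, y) (0, 1) := (h.hasy hp).deriv

lemma Sm.hasx' {u} (h : Sm u) {x y} (hp : (x, y) ∈ B1) :
    HasDerivAt (fun t => u t y) (pdx u x y) x := by
  rw [h.pdx_eq hp]; exact h.hasx hp

lemma Sm.hasy' {u} (h : Sm u) {x y} (hp : (x, y) ∈ B1) :
    HasDerivAt (fun t => u x t) (pdy u x y) y := by
  rw [h.pdy_eq hp]; exact h.hasy hp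

lemma Sm.fderiv_smooth {u} (h : Sm u) :
    ContDiffOn ℝ (⊤ : ℕ∞) (fderiv ℝ (fun p : ℝ × ℝ => u p.1 p.2)) B1 :=
  ContDiffOn.fderiv_of_isOpen h B1_open (by simp)

lemma Sm.pdx {u} (h : Sm u) : Sm (pdx u) :=
  (h.fderiv_smooth.clm_apply (contDiffOn_const (c := ((1 : ℝ), (0 : ℝ))))).congr
    fun p hp => h.pdx_eq (x := p.1) (y := p.2) hp

lemma Sm.pdy {u} (h : Sm u) : Sm (pdy u) :=
  (h.fderiv_smooth.clm_apply (contDiffOn_const (c := ((0 : ℝ), (1 : ℝ))))).congr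
    fun p hp => h.pdy_eq (x := p.1) (y := p.2) hp

lemma EqB.evx {u v} (h : EqB u v) {x y} (hp : (x, y) ∈ B1) :
    (fun t => u t y) =ᶠ[𝓝 x] (fun t => v t y) := by
  have : ∀ᶠ t in 𝓝 x, (t, y) ∈ B1 :=
    (Continuous.prodMk continuous_id continuous_const).continuousAt.eventually
      (B1_open.mem_nhds hp)
  filter_upwards [this] with t ht using h t y ht

lemma EqB.evy {u v} (h : EqB u v) {x y} (hp : (x, y) ∈ B1) :
    (fun t => u x t) =ᶠ[𝓝 y] (fun t => v x t) := by
  have : ∀ᶠ t in 𝓝 y, (x, t) ∈ B1 :=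
    (Continuous.prodMk continuous_const continuous_id).continuousAt.eventually
      (B1_open.mem_nhds hp)
  filter_upwards [this] with t ht using h x t ht

lemma EqB.pdx {u v} (h : EqB u v) : EqB (pdx u) (pdx v) :=
  fun _ _ hp => (h.evx hp).deriv_eq

lemma EqB.pdy {u v} (h : EqB u v) : EqB (pdy u) (pdy v) :=
  fun _ _ hp => (h.evy hp).deriv_eq

lemma EqB.pdxi {u v} (h : EqB u v) (i : ℕ) : EqB (_root_.pdx^[i] u) (_root_.pdx^[i] v) := by
  induction i with
  | zero => exact h
  | succ k ih => simp only [Function.iterate_succ_apply']; exact ih.pdx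

lemma EqB.pdyi {u v} (h : EqB u v) (i : ℕ) : EqB (_root_.pdy^[i] u) (_root_.pdy^[i] v) := by
  induction i with
  | zero => exact h
  | succ k ih => simp only [Function.iterate_succ_apply']; exact ih.pdy

lemma EqB.pd {u v} (h : EqB u v) (i j : ℕ) : EqB (pd u i j) (pd v i j) := (h.pdyi j).pdxi i

lemma Sm.pdyi {u} (h : Sm u) (j : ℕ) : Sm (_root_.pdy^[j] u) := by
  induction j with
  | zero => exact h
  | succ k ih => simp only [Function.iterate_succ_apply']; exact ih.pdy

lemma Sm.pdxi {u} (h : Sm u) (j : ℕ) : Sm (_root_.pdx^[j] u) := by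
  induction j with
  | zero => exact h
  | succ k ih => simp only [Function.iterate_succ_apply']; exact ih.pdx

lemma Sm.pd {u} (h : Sm u) (i j : ℕ) : Sm (pd u i j) := (h.pdyi j).pdxi i

lemma Sm.comm {u} (h : Sm u) : EqB (_root_.pdx (_root_.pdy u)) (_root_.pdy (_root_.pdx u)) := by
  intro x y hp
  rw [h.pdy.pdx_eq hp, h.pdx.pdy_eq hp]
  have hd : DifferentiableAt ℝ (fderiv ℝ (fun p : ℝ × ℝ => u p.1 p.2)) (x, y) :=
    (h.fderiv_smooth.contDiffAt (B1_open.mem_nhds hp)).differentiableAt (by simp)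
  have e1 : (fun p : ℝ × ℝ => _root_.pdy u p.1 p.2) =ᶠ[𝓝 (x, y)]
      fun p => fderiv ℝ (fun p : ℝ × ℝ => u p.1 p.2) p (0, 1) := by
    filter_upwards [B1_open.mem_nhds hp] with p hp' using h.pdy_eq (x := p.1) (y := p.2) hp'
  have e2 : (fun p : ℝ × ℝ => _root_.pdx u p.1 p.2) =ᶠ[𝓝 (x, y)]
      fun p => fderiv ℝ (fun p : ℝ × ℝ => u p.1 p.2) p (1, 0) := by
    filter_upwards [B1_open.mem_nhds hp] with p hp' using h.pdx_eq (x := p.1) (y := p.2) hp'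
  have hs : IsSymmSndFDerivAt ℝ (fun p : ℝ × ℝ => u p.1 p.2) (x, y) :=
    (h.contDiffAt (B1_open.mem_nhds hp)).isSymmSndFDerivAt (by
      rw [minSmoothness_of_isRCLikeNormedField]; exact WithTop.coe_le_coe.2 le_top)
  rw [e1.fderiv_eq, e2.fderiv_eq, fderiv_clm_apply hd (by fun_prop),
    fderiv_clm_apply hd (by fun_prop)]
  simpa using hs.eq (1, 0) (0, 1)

lemma Sm.comm_yi {u} (h : Sm u) (j : ℕ) :
    EqB (_root_.pdx (_root_.pdy^[j] u)) (_root_.pdy^[j] (_root_.pdx u)) := by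
  induction j with
  | zero => intro x y _; rfl
  | succ k ih =>
    simp only [Function.iterate_succ_apply']
    exact (h.pdyi k).comm.trans ih.pdy

lemma Sm.pd_pdx {u} (h : Sm u) (i j : ℕ) : EqB (_root_.pd (_root_.pdx u) i j) (_root_.pd u (i+1) j) := by
  intro x y hp
  exact ((h.comm_yi j).symm.pdxi i) x y hp

lemma pd_pdy (u) (i j : ℕ) : pd (pdy u) i j = pd u i (j+1) := rfl

lemma Sm.add {u v} (h : Sm u) (h' : Sm v) : Sm (fun x y => u x y + v x y) := ContDiffOn.add h h'

lemma Sm.mul {u v} (h : Sm u) (h' : Sm v) : Sm (fun x y => u x y * v x y) := ContDiffOn.mul h h'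

lemma pd_add {u v} (h : Sm u) (h' : Sm v) (i j : ℕ) :
    EqB (pd (fun x y => u x y + v x y) i j) (fun x y => pd u i j x y + pd v i j x y) := by
  have hy : EqB (pdy^[j] (fun x y => u x y + v x y)) (fun x y => pdy^[j] u x y + pdy^[j] v x y) := by
    induction j with
    | zero => intro x y _; rfl
    | succ k ih =>
      simp only [Function.iterate_succ_apply']
      refine ih.pdy.trans fun x y hp => ?_
      exact (((h.pdyi k).hasy' hp).add ((h'.pdyi k).hasy' hp)).deriv
  have := hy.pdxi i
  refine this.trans ?_
  induction i with
  | zero => intro x y _; rfl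
  | succ k ih =>
    have ih := ih (hy.pdxi k)
    simp only [pd, Function.iterate_succ_apply']
    refine ih.pdx.trans fun x y hp => ?_
    exact (((h.pd k j).hasx' hp).add ((h'.pd k j).hasx' hp)).deriv

lemma pdx_mul {u v} (h : Sm u) (h' : Sm v) :
    EqB (pdx (fun x y => u x y * v x y)) (fun x y => pdx u x y * v x y + u x y * pdx v x y) :=
  fun _ _ hp => ((h.hasx' hp).mul (h'.hasx' hp)).deriv

lemma pdy_mul {u v} (h : Sm u) (h' : Sm v) :
    EqB (pdy (fun x y => u x y * v x y)) (fun x y => pdy u x y * v x y + u x y * pdy v x y) :=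
  fun _ _ hp => ((h.hasy' hp).mul (h'.hasy' hp)).deriv

lemma flat_mul (k : ℕ) : ∀ (g v : ℝ → ℝ → ℝ), Sm g → Sm v →
    (∀ i j, i + j ≤ k → pd v i j 0 0 = 0) →
    ∀ i j, i + j ≤ k → pd (fun x y => g x y * v x y) i j 0 0 = 0 := by
  have base : ∀ (g v : ℝ → ℝ → ℝ), pd v 0 0 0 0 = 0 →
      pd (fun x y => g x y * v x y) 0 0 0 0 = 0 := by
    intro g v h
    have h : v 0 0 = 0 := h
    change g 0 0 * v 0 0 = 0
    rw [h, mul_zero]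
  induction k with
  | zero =>
    intro g v hg hv h i j hij
    obtain ⟨rfl, rfl⟩ : i = 0 ∧ j = 0 := by omega
    exact base g v (h 0 0 le_rfl)
  | succ k ih =>
    intro g v hg hv h i j hij
    rcases j with _ | j
    · rcases i with _ | i
      · exact base g v (h 0 0 (by omega))
      · have e := (hg.mul hv).pd_pdx i 0 0 0 B1_zero
        rw [← e, (pdx_mul hg hv).pd i 0 0 0 B1_zero,
          pd_add (hg.pdx.mul hv) (hg.mul hv.pdx) i 0 0 0 B1_zero]
        beta_reduce
        rw [ih _ _ hg.pdx hv (fun i j h' => h i j (by omega)) i 0 (by omega),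
          ih _ _ hg hv.pdx (fun i j h' => by
            rw [hv.pd_pdx i j 0 0 B1_zero]; exact h (i+1) j (by omega)) i 0 (by omega), add_zero]
    · rw [← pd_pdy, (pdy_mul hg hv).pd i j 0 0 B1_zero,
          pd_add (hg.pdy.mul hv) (hg.mul hv.pdy) i j 0 0 B1_zero]
      beta_reduce
      rw [ih _ _ hg.pdy hv (fun i j h' => h i j (by omega)) i j (by omega),
          ih _ _ hg hv.pdy (fun i j h' => by
            rw [pd_pdy]; exact h i (j+1) (by omega)) i j (by omega), add_zero]

lemma pdx_iter (w : ℝ → ℝ → ℝ) (k : ℕ) (x y : ℝ) :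
    pdx^[k] w x y = iteratedDeriv k (fun t => w t y) x := by
  induction k generalizing w with
  | zero => simp
  | succ k ih => rw [Function.iterate_succ_apply, ih, iteratedDeriv_succ']; rfl

lemma Sm.slice {w} (h : Sm w) : ContDiffOn ℝ (⊤ : ℕ∞) (fun t => w t 0) (Metric.ball (0 : ℝ) 1) := by
  have h1 : ContDiffOn ℝ (⊤ : ℕ∞) (fun t : ℝ => (t, (0 : ℝ))) (Metric.ball (0 : ℝ) 1) := by fun_prop
  refine ContDiffOn.comp (g := fun p : ℝ × ℝ => w p.1 p.2) h h1 ?_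
  intro t ht
  simpa [B1, Prod.norm_def] using ht

/-- Taylor expansion at the first non-trivial order, along the `x` axis. -/
lemma taylor_first {w} (h : Sm w) (m : ℕ) (hm : 1 ≤ m)
    (h0 : ∀ k, 1 ≤ k → k < m → pdx^[k] w 0 0 = 0) :
    Tendsto (fun t => (w t 0 - w 0 0) / t ^ m) (𝓝[≠] 0) (𝓝 (pdx^[m] w 0 0 / (m.factorial : ℝ))) := by
  have ht := Real.taylor_tendsto (f := fun t => w t 0) (x₀ := 0) (n := m) (convex_ball (0 : ℝ) 1)
    (by simp) (h.slice.of_le (by exact_mod_cast le_top))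
  rw [(Metric.isOpen_ball).nhdsWithin_eq (by simp)] at ht
  have ht := (ht.mono_left nhdsWithin_le_nhds : Tendsto _ (𝓝[≠] (0 : ℝ)) _)
  have ht2 := ht.add (tendsto_const_nhds (x := pdx^[m] w 0 0 / (m.factorial : ℝ)))
  rw [zero_add] at ht2
  refine ht2.congr' ?_
  filter_upwards [self_mem_nhdsWithin] with t htne
  have htne : t ≠ 0 := htne
  rw [taylor_within_apply, Finset.sum_range_succ, Finset.sum_eq_single 0]
  · rw [iteratedDerivWithin_of_isOpen (n := m) Metric.isOpen_ball (by simp), ← pdx_iter]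
    have : (m.factorial : ℝ) ≠ 0 := by positivity
    simp
    field_simp
    ring
  · intro k hk hk0
    rw [iteratedDerivWithin_of_isOpen Metric.isOpen_ball (by simp), ← pdx_iter,
      h0 k (by omega) (by simpa using hk), smul_zero]
  · intro hk; exact absurd (Finset.mem_range.2 (by omega)) hk

/-- Quadratic estimate in `y`. -/
lemma quad_bound {u} (h : Sm u) : ∃ M : ℝ, 0 < M ∧ ∃ δ > 0, ∀ x y : ℝ, |x| < δ → |y| < δ →
    |u x y - u x 0 - y * pdy u x 0| ≤ M * y ^ 2 := by
  have hc : ContinuousAt (fun p : ℝ × ℝ => pdy (pdy u) p.1 p.2) (0, 0) :=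
    (h.pdy.pdy.contDiffAt (B1_open.mem_nhds B1_zero)).continuousAt
  set M := |pdy (pdy u) 0 0| + 1 with hM
  have h1 : ∀ᶠ p : ℝ × ℝ in 𝓝 (0, 0), |pdy (pdy u) p.1 p.2| < M :=
    hc.abs.eventually_lt_const (by simp [hM])
  obtain ⟨δ, hδ, hb⟩ := Metric.eventually_nhds_iff_ball.1 (h1.and (B1_open.mem_nhds B1_zero))
  refine ⟨M, by positivity, δ, hδ, fun x y hx hy => ?_⟩
  have mem : ∀ s, |s| ≤ |y| → (x, s) ∈ Metric.ball ((0 : ℝ), (0 : ℝ)) δ := by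
    intro s hs
    simp only [Metric.mem_ball, Prod.dist_eq, Real.dist_eq, sub_zero]
    exact max_lt hx (hs.trans_lt hy)
  have hcv : Convex ℝ (Set.Icc (-|y|) |y|) := convex_Icc _ _
  have m0 : (0 : ℝ) ∈ Set.Icc (-|y|) |y| := by simp
  have my : y ∈ Set.Icc (-|y|) |y| := ⟨neg_abs_le y, le_abs_self y⟩
  have d1 : ∀ s ∈ Set.Icc (-|y|) |y|, |pdy u x s - pdy u x 0| ≤ M * |y| := by
    intro s hs
    have := hcv.norm_image_sub_le_of_norm_hasDerivWithin_le (f := fun s => pdy u x s)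
      (f' := fun s => pdy (pdy u) x s) (C := M)
      (fun s hs => (h.pdy.hasy' (hb _ (mem s (abs_le.2 hs))).2).hasDerivWithinAt)
      (fun s hs => (hb _ (mem s (abs_le.2 hs))).1.le) m0 hs
    simp only [Real.norm_eq_abs, sub_zero] at this
    exact this.trans (mul_le_mul_of_nonneg_left (abs_le.2 hs) (by positivity))
  have := hcv.norm_image_sub_le_of_norm_hasDerivWithin_le (f := fun s => u x s - s * pdy u x 0)
      (f' := fun s => pdy u x s - 1 * pdy u x 0) (C := M * |y|)
      (fun s hs => ((h.hasy' (hb _ (mem s (abs_le.2 hs))).2).sub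
        ((hasDerivAt_id s).mul_const _)).hasDerivWithinAt)
      (fun s hs => by simpa using d1 s hs) m0 my
  simp only [Real.norm_eq_abs, sub_zero, zero_mul] at this
  rw [mul_assoc, abs_mul_abs_self] at this
  calc _ = |u x y - y * pdy u x 0 - u x 0| := by congr 1; ring
    _ ≤ _ := by rw [pow_two]; exact this

lemma max_slice {u : ℝ → ℝ → ℝ} (hmax : IsLocalMax (fun p : ℝ × ℝ => u p.1 p.2) (0, 0)) :
    ∀ᶠ t in 𝓝 (0 : ℝ), u t 0 ≤ u 0 0 := by
  have : Tendsto (fun t : ℝ => (t, (0 : ℝ))) (𝓝 0) (𝓝 (0, 0)) := by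
    have : Continuous (fun t : ℝ => (t, (0 : ℝ))) := by fun_prop
    exact this.tendsto 0
  exact this.eventually hmax

lemma first_nonpos {u} (h : Sm u) (hmax : IsLocalMax (fun p : ℝ × ℝ => u p.1 p.2) (0, 0))
    (m : ℕ) (hm : 1 ≤ m) (h0 : ∀ k, 1 ≤ k → k < m → pd u k 0 0 0 = 0) :
    pd u m 0 0 0 ≤ 0 := by
  have ht := (taylor_first h m hm h0).mono_left
    (nhdsWithin_mono 0 (fun t (ht : 0 < t) => ht.ne') : 𝓝[>] (0:ℝ) ≤ 𝓝[≠] 0)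
  have : pdx^[m] u 0 0 / (m.factorial : ℝ) ≤ 0 := by
    refine le_of_tendsto ht ?_
    filter_upwards [(max_slice hmax).filter_mono nhdsWithin_le_nhds, self_mem_nhdsWithin] with t h1 h2
    exact div_nonpos_of_nonpos_of_nonneg (by linarith) (pow_nonneg (le_of_lt h2) _)
  have hf : (0 : ℝ) < m.factorial := by positivity
  have h3 := (div_le_iff₀ hf).1 this
  rw [zero_mul] at h3
  exact h3

lemma first_nonneg_odd {u} (h : Sm u) (hmax : IsLocalMax (fun p : ℝ × ℝ => u p.1 p.2) (0, 0))
    (m : ℕ) (hm : 1 ≤ m) (ho : Odd m) (h0 : ∀ k, 1 ≤ k → k < m → pd u k 0 0 0 = 0) :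
    0 ≤ pd u m 0 0 0 := by
  have ht := (taylor_first h m hm h0).mono_left
    (nhdsWithin_mono 0 (fun t (ht : t < 0) => ht.ne) : 𝓝[<] (0:ℝ) ≤ 𝓝[≠] 0)
  have : 0 ≤ pdx^[m] u 0 0 / (m.factorial : ℝ) := by
    refine ge_of_tendsto ht ?_
    filter_upwards [(max_slice hmax).filter_mono nhdsWithin_le_nhds, self_mem_nhdsWithin] with t h1 h2
    exact div_nonneg_of_nonpos (by linarith) (ho.pow_neg h2).le
  have hf : (0 : ℝ) < m.factorial := by positivity
  have h3 := (le_div_iff₀ hf).1 this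
  rw [zero_mul] at h3
  exact h3

/-- If the pure `x` derivatives vanish up to order `2N`, then the mixed one of order `(N,1)` does. -/
lemma mixed_zero {u} (h : Sm u) (hmax : IsLocalMax (fun p : ℝ × ℝ => u p.1 p.2) (0, 0))
    (N : ℕ) (hN : 1 ≤ N) (h0 : ∀ k, 1 ≤ k → k ≤ 2 * N → pd u k 0 0 0 = 0)
    (h1 : ∀ k, k < N → pd u k 1 0 0 = 0) : pd u N 1 0 0 = 0 := by
  obtain ⟨M, hM, δ, hδ, hq⟩ := quad_bound h
  set B := pdx^[N] (pdy u) 0 0 / (N.factorial : ℝ) with hB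
  have le : 𝓝[>] (0:ℝ) ≤ 𝓝[≠] 0 := nhdsWithin_mono 0 (fun t (ht : 0 < t) => ht.ne')
  have t1 : Tendsto (fun t => (u t 0 - u 0 0) / t ^ (2 * N)) (𝓝[>] 0) (𝓝 0) := by
    have := (taylor_first h (2 * N) (by omega) (fun k hk hk' => h0 k hk hk'.le)).mono_left le
    have e : pdx^[2 * N] u 0 0 = 0 := h0 (2 * N) (by omega) le_rfl
    rwa [e, zero_div] at this
  have t2 : Tendsto (fun t => pdy u t 0 / t ^ N) (𝓝[>] 0) (𝓝 B) := by
    have := (taylor_first h.pdy N hN (fun k hk hk' => h1 k hk')).mono_left le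
    have e : pdy u 0 0 = 0 := h1 0 (by omega)
    simpa only [e, sub_zero] using this
  have key : ∀ c : ℝ, c * B - M * c ^ 2 ≤ 0 := by
    intro c
    have t3 : Tendsto (fun t => (u t 0 - u 0 0) / t ^ (2 * N) + c * (pdy u t 0 / t ^ N) - M * c ^ 2)
        (𝓝[>] 0) (𝓝 (0 + c * B - M * c ^ 2)) := (t1.add (t2.const_mul c)).sub_const _
    rw [zero_add] at t3
    refine le_of_tendsto t3 ?_
    have ty : Tendsto (fun t : ℝ => c * t ^ N) (𝓝 0) (𝓝 0) := by
      have : Continuous (fun t : ℝ => c * t ^ N) := by fun_prop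
      simpa [show N ≠ 0 by omega] using this.tendsto 0
    have tm : ∀ᶠ t in 𝓝 (0:ℝ), u t (c * t ^ N) ≤ u 0 0 := by
      have : Tendsto (fun t : ℝ => (t, c * t ^ N)) (𝓝 0) (𝓝 (0, 0)) := by
        rw [nhds_prod_eq]; exact tendsto_id.prodMk ty
      exact this.eventually hmax
    have e1 : ∀ᶠ t in 𝓝 (0:ℝ), |t| < δ := by
      simpa using (continuous_abs.tendsto (0:ℝ)).eventually_lt_const (by simpa using hδ)
    have e2 : ∀ᶠ t in 𝓝 (0:ℝ), |c * t ^ N| < δ := by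
      simpa using ty.abs.eventually_lt_const (by simpa using hδ)
    filter_upwards [tm.filter_mono nhdsWithin_le_nhds, e1.filter_mono nhdsWithin_le_nhds,
      e2.filter_mono nhdsWithin_le_nhds, self_mem_nhdsWithin] with t a1 a2 a3 a4
    have a4 : 0 < t := a4
    have b := (abs_le.1 (hq t (c * t ^ N) a2 a3)).1
    have hp : 0 < t ^ N := pow_pos a4 _
    have e : (u t 0 - u 0 0) / t ^ (2 * N) + c * (pdy u t 0 / t ^ N) - M * c ^ 2
        = (u t 0 - u 0 0 + c * t ^ N * pdy u t 0 - M * (c * t ^ N) ^ 2) / (t ^ N) ^ 2 := by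
      rw [mul_comm 2 N, pow_mul]
      field_simp
    rw [e]
    exact div_nonpos_of_nonpos_of_nonneg (by linarith) (by positivity)
  have hB0 : B = 0 := by
    by_contra hne
    have := key (B / (2 * M))
    have e : B / (2 * M) * B - M * (B / (2 * M)) ^ 2 = B ^ 2 / (4 * M) := by
      field_simp; ring
    rw [e] at this
    have : 0 < B ^ 2 / (4 * M) := by positivity
    linarith
  have hf : (N.factorial : ℝ) ≠ 0 := by positivity
  exact (div_eq_zero_iff.1 hB0).resolve_right hf

/-- Differentiated equation at the origin. -/
lemma harmonic_part {u : ℝ → ℝ → ℝ} {f : ℝ → ℝ} (h : Sm u) (hf : ContDiff ℝ (⊤ : ℕ∞) f)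
    (hpde : ∀ x y : ℝ, (x, y) ∈ B1 → -(pd u 2 0 x y + pd u 0 2 x y) = f (u x y))
    (k : ℕ) (h0 : ∀ i j, i + j ≤ k → pd u (i + 1) j 0 0 = 0) (i j : ℕ) (hij : i + j ≤ k) :
    pd u (i + 3) j 0 0 + pd u (i + 1) (j + 2) 0 0 = 0 := by
  have hg : Sm (fun x y => -deriv f (u x y)) := by
    have h1 : ContDiff ℝ (⊤ : ℕ∞) (deriv f) := (contDiff_infty_iff_deriv.1 hf).2
    exact (h1.comp_contDiffOn h).neg
  have e1 : EqB (fun x y => pd (pdx u) 2 0 x y + pd (pdx u) 0 2 x y)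
      (fun x y => -deriv f (u x y) * pdx u x y) := by
    have a : EqB (fun x y => pd u 2 0 x y + pd u 0 2 x y) (fun x y => - f (u x y)) :=
      fun x y hp => by beta_reduce; rw [← hpde x y hp]; simp
    have b : EqB (pdx (fun x y => pd u 2 0 x y + pd u 0 2 x y))
        (fun x y => pd (pdx u) 2 0 x y + pd (pdx u) 0 2 x y) := fun x y hp => by
      beta_reduce
      rw [h.pd_pdx 2 0 x y hp, h.pd_pdx 0 2 x y hp]
      exact (((h.pd 2 0).hasx' hp).add ((h.pd 0 2).hasx' hp)).deriv
    refine b.symm.trans (a.pdx.trans fun x y hp => ?_)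
    have hfd : HasDerivAt f (deriv f (u x y)) (u x y) :=
      (hf.differentiable (by simp) _).hasDerivAt
    have := (HasDerivAt.comp x hfd (h.hasx' hp)).neg.deriv
    rw [neg_mul]
    exact this
  have e2 := e1.pd i j 0 0 B1_zero
  rw [flat_mul k _ _ hg h.pdx (fun i j hij => by
      rw [h.pd_pdx i j 0 0 B1_zero]; exact h0 i j hij) i j hij,
    pd_add (h.pdx.pd 2 0) (h.pdx.pd 0 2) i j 0 0 B1_zero] at e2
  have c1 : pd (pd (pdx u) 2 0) i j 0 0 = pd u (i + 3) j 0 0 := by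
    change pd (pdx (pdx (pdx u))) i j 0 0 = _
    rw [h.pdx.pdx.pd_pdx i j 0 0 B1_zero, h.pdx.pd_pdx (i + 1) j 0 0 B1_zero,
      h.pd_pdx (i + 2) j 0 0 B1_zero]
  have c2 : pd (pd (pdx u) 0 2) i j 0 0 = pd u (i + 1) (j + 2) 0 0 := by
    change pd (pdx u) i (j + 2) 0 0 = _
    rw [h.pd_pdx i (j + 2) 0 0 B1_zero]
  rw [← c1, ← c2]; exact e2

/-- Morse Lemma for degenerate maximum points, case `n` odd:
`∂ⁿu/∂xⁿ(0,0) = 0`, `∂ⁿu/∂x^(n-1)∂y(0,0) ≠ 0`, and the smallest `l > n` with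
`∂ˡu/∂xˡ(0,0) ≠ 0` exists, satisfies `n+1 ≤ l ≤ 2n-2` and `∂ˡu/∂xˡ(0,0) < 0`. -/
theorem degenerate_max_odd_derivatives
    (u : ℝ → ℝ → ℝ) (f : ℝ → ℝ)
    (hu : ContDiffOn ℝ (⊤ : ℕ∞) (fun p : ℝ × ℝ => u p.1 p.2) B1)
    (hf : ContDiff ℝ (⊤ : ℕ∞) f)
    (hpde : ∀ x y : ℝ, (x, y) ∈ B1 → -(pd u 2 0 x y + pd u 0 2 x y) = f (u x y))
    (hnc : ¬ ∃ c : ℝ, ∀ x y : ℝ, (x, y) ∈ B1 → u x y = c)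
    (hcx : pd u 1 0 0 0 = 0) (hcy : pd u 0 1 0 0 = 0)
    (hmax : IsLocalMax (fun p : ℝ × ℝ => u p.1 p.2) (0, 0))
    (hdeg : pd u 2 0 0 0 * pd u 0 2 0 0 - (pd u 1 1 0 0) ^ 2 = 0)
    (hxx : pd u 2 0 0 0 = 0) (hxy : pd u 1 1 0 0 = 0)
    (hux : ¬ ∀ x y : ℝ, (x, y) ∈ B1 → pd u 1 0 x y = 0)
    (n : ℕ) (hn3 : 3 ≤ n)
    (hnex : ∃ k, k < n ∧ pd u (n - k) k 0 0 ≠ 0)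
    (hnmin : ∀ m, 3 ≤ m → m < n → ∀ k, k < m → pd u (m - k) k 0 0 = 0)
    (hnodd : Odd n) :
    pd u n 0 0 0 = 0 ∧ pd u (n - 1) 1 0 0 ≠ 0 ∧
    ∃ l : ℕ, n + 1 ≤ l ∧ l ≤ 2 * n - 2 ∧
      pd u l 0 0 0 < 0 ∧
      (∀ m : ℕ, n < m → m < l → pd u m 0 0 0 = 0) := by
  have h : Sm u := hu
  -- all mixed derivatives of order below `n` vanish
  have hlow : ∀ i j, i + 1 + j < n → pd u (i + 1) j 0 0 = 0 := by
    intro i j hij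
    by_cases h3 : 3 ≤ i + 1 + j
    · have := hnmin (i + 1 + j) h3 hij j (by omega)
      rwa [show i + 1 + j - j = i + 1 by omega] at this
    · have hc : (i = 0 ∧ j = 0) ∨ (i = 1 ∧ j = 0) ∨ (i = 0 ∧ j = 1) := by omega
      rcases hc with ⟨rfl, rfl⟩ | ⟨rfl, rfl⟩ | ⟨rfl, rfl⟩
      · exact hcx
      · exact hxx
      · exact hxy
  have hx : ∀ k, 1 ≤ k → k < n → pd u k 0 0 0 = 0 := by
    intro k hk hk'
    have := hlow (k - 1) 0 (by omega)
    rwa [show k - 1 + 1 = k by omega] at this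
  have hA : pd u n 0 0 0 = 0 :=
    le_antisymm (first_nonpos h hmax n (by omega) hx)
      (first_nonneg_odd h hmax n (by omega) hnodd hx)
  have hB : pd u (n - 1) 1 0 0 ≠ 0 := by
    intro hB
    have hall : ∀ k, k < n → pd u (n - k) k 0 0 = 0 := by
      intro k
      induction k using Nat.strong_induction_on with
      | _ k ih =>
        intro hk
        rcases k with _ | _ | k
        · exact hA
        · exact hB
        · have e := harmonic_part h hf hpde (n - 3) (fun i j hij => hlow i j (by omega))
            (n - 3 - k) k (by omega)
          have e0 := ih k (by omega) (by omega)
          rw [show n - 3 - k + 3 = n - k by omega, e0, zero_add,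
            show n - 3 - k + 1 = n - (k + 2) by omega] at e
          exact e
    obtain ⟨k, hk, hne⟩ := hnex
    exact hne (hall k hk)
  refine ⟨hA, hB, ?_⟩
  have hex : ∃ l, n < l ∧ l ≤ 2 * (n - 1) ∧ pd u l 0 0 0 ≠ 0 := by
    by_contra hcon
    push Not at hcon
    refine hB (mixed_zero h hmax (n - 1) (by omega) (fun k hk hk' => ?_) (fun k hk => ?_))
    · rcases lt_trichotomy k n with hlt | heq | hgt
      · exact hx k hk hlt
      · rw [heq]; exact hA
      · exact hcon k hgt hk'
    · rcases k with _ | k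
      · exact hcy
      · exact hlow k 1 (by omega)
  classical
  obtain ⟨hl1, hl2, hl3⟩ := Nat.find_spec hex
  have hmin : ∀ m : ℕ, n < m → m < Nat.find hex → pd u m 0 0 0 = 0 := by
    intro m hm hm'
    by_contra hne
    exact Nat.find_min hex hm' ⟨hm, by omega, hne⟩
  refine ⟨Nat.find hex, by omega, by omega, lt_of_le_of_ne ?_ hl3, hmin⟩
  refine first_nonpos h hmax _ (by omega) (fun k hk hk' => ?_)
  rcases lt_trichotomy k n with hlt | heq | hgt
  · exact hx k hk hlt
  · rw [heq]; exact hA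
  · exact hmin k hgt hk'
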